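/- Let K be a field. For λ, μ ∈ K with λ ≠ μ, the representations M(λ) and M(μ) of the cube poset {0,1}³ are not isomorphic. -/

import Mathlib

open Classical

structure PRep (K : Type) [Field K] (P : Type) [PartialOrder P] : Type 1 where
  V : P → Type
  [isAddCommGroup : ∀ x, AddCommGroup (V x)]
  [isModule : ∀ x, Module K (V x)]
  [isFinite : ∀ x, Module.Finite K (V x)]
  map : ∀ {x y : P}, x ≤ y → (V x →ₗ[K] V y)
  map_refl : ∀ x : P, map (le_refl x) = LinearMap.id
  map_trans : ∀ {x y z : P} (hxy : x ≤ y) (hyz : y ≤ z),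
    map (le_trans hxy hyz) = (map hyz).comp (map hxy)

attribute [instance] PRep.isAddCommGroup PRep.isModule PRep.isFinite

variable {K : Type} [Field K] {P : Type} [PartialOrder P]

namespace PRep

/-- Isomorphism of representations. -/
def Iso (M N : PRep K P) : Prop :=
  ∃ e : ∀ x : P, M.V x ≃ₗ[K] N.V x,
    ∀ (x y : P) (h : x ≤ y),
      (N.map h).comp (e x : M.V x →ₗ[K] N.V x)
        = (e y : M.V y →ₗ[K] N.V y).comp (M.map h)

/-- Pointwise direct sum of two representations. -/
def dsum (M N : PRep K P) : PRep K P where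
  V x := M.V x × N.V x
  map h := (M.map h).prodMap (N.map h)
  map_refl x := by
    apply LinearMap.ext; intro v
    simp [M.map_refl, N.map_refl]
  map_trans hxy hyz := by
    apply LinearMap.ext; intro v
    simp [M.map_trans hxy hyz, N.map_trans hxy hyz]

def IsThin (M : PRep K P) : Prop := ∀ x : P, Module.finrank K (M.V x) ≤ 1

def supp (M : PRep K P) : Set P := {x : P | Nontrivial (M.V x)}

def Indecomposable (M : PRep K P) : Prop :=
  (∃ x : P, Nontrivial (M.V x)) ∧
  ∀ N₁ N₂ : PRep K P, M.Iso (N₁.dsum N₂) →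
    (∀ x : P, Subsingleton (N₁.V x)) ∨ (∀ x : P, Subsingleton (N₂.V x))

end PRep

/-- Convexity of a subset of a poset. -/
def IsConvexSet (I : Set P) : Prop :=
  ∀ ⦃a b c : P⦄, a ∈ I → c ∈ I → a ≤ b → b ≤ c → b ∈ I

/-- Connectedness of a subset of a poset. -/
def IsConnectedSet (I : Set P) : Prop :=
  ∀ a ∈ I, ∀ b ∈ I,
    Relation.ReflTransGen (fun u v : P => u ∈ I ∧ v ∈ I ∧ (u ≤ v ∨ v ≤ u)) a b

/-- An interval of a poset: nonempty, convex and connected subset. -/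
def IsIntervalSet (I : Set P) : Prop :=
  I.Nonempty ∧ IsConvexSet I ∧ IsConnectedSet I

/-- The interval representation associated to a convex subset `I`. -/
noncomputable def intervalRep (K : Type) [Field K] {P : Type} [PartialOrder P]
    (I : Set P) (hI : IsConvexSet I) : PRep K P where
  V x := ↥(if x ∈ I then (⊤ : Submodule K K) else ⊥)
  map {x y} h :=
    { toFun := fun v => ⟨if y ∈ I then (v : K) else 0, by
        by_cases hy : y ∈ I
        · simp [hy]
        · simp only [if_neg hy]
          exact Submodule.zero_mem _⟩
      map_add' := fun v w => by
        apply Subtype.ext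
        by_cases hy : y ∈ I <;> simp [hy]
      map_smul' := fun c v => by
        apply Subtype.ext
        by_cases hy : y ∈ I <;> simp [hy] }
  map_refl x := by
    apply LinearMap.ext; intro v
    apply Subtype.ext
    by_cases hx : x ∈ I
    · simp [hx]
    · have hv0 : (v : K) = 0 := (Submodule.mem_bot K).1
        ((if_neg hx : (if x ∈ I then (⊤ : Submodule K K) else ⊥) = ⊥).le v.2)
      exact (if_neg hx).trans hv0.symm
  map_trans {x y z} hxy hyz := by
    apply LinearMap.ext; intro v
    apply Subtype.ext
    by_cases hz : z ∈ I
    · by_cases hy : y ∈ I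
      · show (if z ∈ I then (v : K) else 0)
            = if z ∈ I then (if y ∈ I then (v : K) else 0) else 0
        rw [if_pos hy]
      · by_cases hx : x ∈ I
        · exact absurd (hI hx hz hxy hyz) hy
        · have hv0 : (v : K) = 0 := (Submodule.mem_bot K).1
            ((if_neg hx : (if x ∈ I then (⊤ : Submodule K K) else ⊥) = ⊥).le v.2)
          simp [hz, hy, hv0]
    · simp [hz]

namespace PRep

def IsPreInterval (M : PRep K P) : Prop :=
  M.IsThin ∧ IsIntervalSet M.supp ∧
    ∀ (x y : P) (h : x ≤ y), x ∈ M.supp → y ∈ M.supp → M.map h ≠ 0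

end PRep

/-- The cube poset `{0,1}³` with the componentwise order. -/
abbrev Cube : Type := Fin 2 × Fin 2 × Fin 2

def cubeBot : Cube := (0, 0, 0)
def cubeTop : Cube := (1, 1, 1)
def cubeA : Cube := (0, 0, 1)
def cubeB : Cube := (0, 1, 1)

/-- Scalar coefficient of the structure map of `M(λ)` from `x` to `y`:
zero into/out of the two zero vertices, `λ` on the covering relation
`(0,0,1) ≤ (0,1,1)`, and `1` otherwise. -/
noncomputable def cubeCoef {K : Type} [Field K] (lam : K) (x y : Cube) : K :=
  if x = cubeBot ∨ x = cubeTop ∨ y = cubeBot ∨ y = cubeTop then 0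
  else if x = cubeA ∧ y = cubeB then lam else 1

lemma cubeCoef_self {K : Type} [Field K] (lam : K) (x : Cube)
    (hx : ¬(x = cubeBot ∨ x = cubeTop)) : cubeCoef lam x x = 1 := by
  unfold cubeCoef
  rw [if_neg (by tauto), if_neg]
  rintro ⟨h1, h2⟩
  rw [h1] at h2
  exact absurd h2 (by decide)

lemma cubeCoef_zero_right {K : Type} [Field K] (lam : K) (x y : Cube)
    (hy : y = cubeBot ∨ y = cubeTop) : cubeCoef lam x y = 0 := by
  unfold cubeCoef
  rw [if_pos (by tauto)]

lemma cube_le_bot : ∀ x : Cube, x ≤ cubeBot → x = cubeBot := by decide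

lemma cube_top_le : ∀ z : Cube, cubeTop ≤ z → z = cubeTop := by decide

lemma cube_mid_between : ∀ x y z : Cube, x ≤ y → y ≤ z →
    ¬(x = cubeBot ∨ x = cubeTop) → ¬(y = cubeBot ∨ y = cubeTop) →
    ¬(z = cubeBot ∨ z = cubeTop) → y = x ∨ y = z := by decide

/-- The representation `M(λ)` of the cube poset. -/
noncomputable def cubeRep (K : Type) [Field K] (lam : K) : PRep K Cube where
  V v := ↥(if v = cubeBot ∨ v = cubeTop then (⊥ : Submodule K K) else ⊤)
  map {x y} h :=
    { toFun := fun v => ⟨cubeCoef lam x y * (v : K), by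
        by_cases hy : y = cubeBot ∨ y = cubeTop
        · simp only [if_pos hy, cubeCoef_zero_right lam x y hy, zero_mul]
          exact Submodule.zero_mem _
        · simp [hy]⟩
      map_add' := fun v w => by
        apply Subtype.ext; simp [mul_add]
      map_smul' := fun c v => by
        apply Subtype.ext; simp; ring }
  map_refl x := by
    apply LinearMap.ext; intro v; apply Subtype.ext
    by_cases hx : x = cubeBot ∨ x = cubeTop
    · have hv0 : (v : K) = 0 := (Submodule.mem_bot K).1
        ((if_pos hx : (if x = cubeBot ∨ x = cubeTop then (⊥ : Submodule K K) else ⊤) = ⊥).le v.2)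
      show cubeCoef lam x x * (v : K) = (v : K)
      rw [hv0, mul_zero]
    · show cubeCoef lam x x * (v : K) = (v : K)
      rw [cubeCoef_self lam x hx, one_mul]
  map_trans {x y z} hxy hyz := by
    apply LinearMap.ext; intro v; apply Subtype.ext
    show cubeCoef lam x z * (v : K)
        = cubeCoef lam y z * (cubeCoef lam x y * (v : K))
    by_cases hv : (v : K) = 0
    · simp [hv]
    have hx : ¬(x = cubeBot ∨ x = cubeTop) := fun hx =>
      hv ((Submodule.mem_bot K).1
        ((if_pos hx : (if x = cubeBot ∨ x = cubeTop then (⊥ : Submodule K K) else ⊤) = ⊥).le v.2))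
    by_cases hz : z = cubeBot ∨ z = cubeTop
    · rw [cubeCoef_zero_right lam x z hz, cubeCoef_zero_right lam y z hz]
      ring
    by_cases hy : y = cubeBot ∨ y = cubeTop
    · exfalso
      rcases hy with hy | hy
      · subst hy
        exact hx (Or.inl (cube_le_bot x hxy))
      · subst hy
        exact hz (Or.inr (cube_top_le z hyz))
    have hkey : y = x ∨ y = z := cube_mid_between x y z hxy hyz hx hy hz
    rcases hkey with h | h
    · subst h
      rw [cubeCoef_self lam y hy]
      ring
    · subst h
      rw [cubeCoef_self lam y hy]
      ring

/-- The generator of `M(λ)` at each vertex: `0` at the two zero vertices and `1` elsewhere. -/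
noncomputable def cubeGen (K : Type) [Field K] (lam : K) (v : Cube) : (cubeRep K lam).V v :=
  (⟨if v = cubeBot ∨ v = cubeTop then 0 else 1, by
      split_ifs
      · exact Submodule.zero_mem _
      · exact Submodule.mem_top⟩ :
    ↥(if v = cubeBot ∨ v = cubeTop then (⊥ : Submodule K K) else ⊤))

/-- The inclusion of `M(λ)(v)` into `K`. -/
noncomputable def cubeVal (K : Type) [Field K] (lam : K) (v : Cube) :
    (cubeRep K lam).V v →ₗ[K] K :=
  Submodule.subtype (if v = cubeBot ∨ v = cubeTop then (⊥ : Submodule K K) else ⊤)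

lemma cubeVal_injective {K : Type} [Field K] (lam : K) (v : Cube) :
    Function.Injective (cubeVal K lam v) :=
  Submodule.subtype_injective _

lemma cubeVal_gen {K : Type} [Field K] (lam : K) (v : Cube)
    (hv : ¬(v = cubeBot ∨ v = cubeTop)) : cubeVal K lam v (cubeGen K lam v) = 1 :=
  if_neg hv

lemma cubeVal_map {K : Type} [Field K] (lam : K) {x y : Cube} (h : x ≤ y)
    (w : (cubeRep K lam).V x) :
    cubeVal K lam y ((cubeRep K lam).map h w) = cubeCoef lam x y * cubeVal K lam x w :=
  rfl

lemma cubeRep_map_gen {K : Type} [Field K] (lam : K) {x y : Cube} (h : x ≤ y)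
    (hx : ¬(x = cubeBot ∨ x = cubeTop)) (hy : ¬(y = cubeBot ∨ y = cubeTop)) :
    (cubeRep K lam).map h (cubeGen K lam x) = cubeCoef lam x y • cubeGen K lam y := by
  apply cubeVal_injective lam y
  rw [cubeVal_map, map_smul, cubeVal_gen lam x hx, cubeVal_gen lam y hy, smul_eq_mul]

/-- An isomorphism `M(λ) ≅ M(μ)` is given by nonzero scalars at the nonzero vertices that
intertwine the coefficients of the structure maps. -/
lemma exists_scalars_of_cubeRep_iso {K : Type} [Field K] {lam mu : K}
    (hiso : (cubeRep K lam).Iso (cubeRep K mu)) :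
    ∃ c : Cube → K, (∀ v, ¬(v = cubeBot ∨ v = cubeTop) → c v ≠ 0) ∧
      ∀ x y, x ≤ y → ¬(x = cubeBot ∨ x = cubeTop) → ¬(y = cubeBot ∨ y = cubeTop) →
        cubeCoef mu x y * c x = cubeCoef lam x y * c y := by
  obtain ⟨e, he⟩ := hiso
  refine ⟨fun v => cubeVal K mu v (e v (cubeGen K lam v)), fun v hv h0 => ?_,
    fun x y hxy hx hy => ?_⟩
  · have h1 : e v (cubeGen K lam v) = 0 := cubeVal_injective mu v (h0.trans (map_zero _).symm)
    have h2 : cubeGen K lam v = 0 := (e v).map_eq_zero_iff.1 h1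
    have h3 := cubeVal_gen lam v hv
    rw [h2, map_zero] at h3
    exact zero_ne_one h3
  · have hnat : (cubeRep K mu).map hxy (e x (cubeGen K lam x)) =
        e y ((cubeRep K lam).map hxy (cubeGen K lam x)) :=
      LinearMap.congr_fun (he x y hxy) (cubeGen K lam x)
    rw [cubeRep_map_gen lam hxy hx hy, map_smul] at hnat
    have hval := congrArg (cubeVal K mu y) hnat
    rwa [cubeVal_map, map_smul, smul_eq_mul] at hval

/-- For `λ ≠ μ`, the representations `M(λ)` and `M(μ)` of the
cube poset are not isomorphic. -/
theorem cubeRep_not_iso_of_ne (K : Type) [Field K] (lam mu : K)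
    (h : lam ≠ mu) : ¬ (cubeRep K lam).Iso (cubeRep K mu) := by
  intro hiso
  obtain ⟨c, hc, hnat⟩ := exists_scalars_of_cubeRep_iso hiso
  have edge : ∀ x y : Cube, x ≤ y → ¬(x = cubeBot ∨ x = cubeTop) →
      ¬(y = cubeBot ∨ y = cubeTop) → ¬(x = cubeA ∧ y = cubeB) → c x = c y := by
    intro x y hxy hx hy hAB
    have hcoef : ∀ t : K, cubeCoef t x y = 1 := fun t => by
      unfold cubeCoef
      rw [if_neg (by tauto), if_neg hAB]
    simpa [hcoef] using hnat x y hxy hx hy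
  have hcycle : c cubeA = c cubeB :=
    calc c cubeA = c (1, 0, 1) := edge _ _ (by decide) (by decide) (by decide) (by decide)
      _ = c (1, 0, 0) := (edge _ _ (by decide) (by decide) (by decide) (by decide)).symm
      _ = c (1, 1, 0) := edge _ _ (by decide) (by decide) (by decide) (by decide)
      _ = c (0, 1, 0) := (edge _ _ (by decide) (by decide) (by decide) (by decide)).symm
      _ = c cubeB := edge _ _ (by decide) (by decide) (by decide) (by decide)
  have hcoefAB : ∀ t : K, cubeCoef t cubeA cubeB = t := fun t => by
    unfold cubeCoef
    rw [if_neg (by decide), if_pos ⟨rfl, rfl⟩]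
  have hAB := hnat cubeA cubeB (by decide) (by decide) (by decide)
  rw [hcoefAB, hcoefAB, hcycle] at hAB
  exact h (mul_right_cancel₀ (hc cubeB (by decide)) hAB).symm
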